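/- Consider the modified single-sequence SDP with parameter n ≥ 3 in which the last constraint matrix is replaced by A_{n−1} = −E_{n−1} + E_{n−2,n}, with all other data unchanged (A₁ = E₁, A_i = E_i + E_{i−1,n} for 2 ≤ i ≤ n−2, B = I_{n−1} ⊕ 0₁, c = e_{n−1}). Then val(P) = 0 and the dual (D) is infeasible (there is no positive semidefinite Y with trace(AᵢY) = cᵢ for all i), so val(D) = +∞ and the duality gap is infinite. -/

import Mathlib

open Matrix

/-- The optimal value of the primal SDP (P). -/
noncomputable def valP {n m : ℕ} (A : Fin m → Matrix (Fin n) (Fin n) ℝ)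
    (B : Matrix (Fin n) (Fin n) ℝ) (c : Fin m → ℝ) : EReal :=
  sSup ((fun x : Fin m → ℝ => ((∑ i, c i * x i : ℝ) : EReal)) ''
    {x | (B - ∑ i, x i • A i).PosSemidef})

/-- The optimal value of the dual SDP (D). -/
noncomputable def valD {n m : ℕ} (A : Fin m → Matrix (Fin n) (Fin n) ℝ)
    (B : Matrix (Fin n) (Fin n) ℝ) (c : Fin m → ℝ) : EReal :=
  sInf ((fun Y : Matrix (Fin n) (Fin n) ℝ => (((B * Y).trace : ℝ) : EReal)) ''
    {Y | Y.PosSemidef ∧ ∀ i, ((A i) * Y).trace = c i})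

/-- `Eij n i j` : the `n×n` symmetric matrix whose only nonzero entries are `1`
in positions `(i,j)` and `(j,i)` (0-based indices). -/
def Eij (n i j : ℕ) : Matrix (Fin n) (Fin n) ℝ :=
  Matrix.of fun a b => if (a.val = i ∧ b.val = j) ∨ (a.val = j ∧ b.val = i) then 1 else 0

/-- The constraint matrices of the modified single-sequence SDP (0-based index `k`):
`A₁ = E₁`, `Aᵢ = Eᵢ + E_{i-1,n}` for `i = 2, …, n-2`, and the modified last matrix
`A_{n-1} = -E_{n-1} + E_{n-2,n}` (1-based indices of the paper). -/
def singleA' (n : ℕ) : Fin (n - 1) → Matrix (Fin n) (Fin n) ℝ := fun k =>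
  if k.val = 0 then Eij n 0 0
  else if k.val = n - 2 then -(Eij n (n - 2) (n - 2)) + Eij n (n - 3) (n - 1)
  else Eij n k.val k.val + Eij n (k.val - 1) (n - 1)

/-- The right hand side of the single-sequence SDP: `B = I_{n-1} ⊕ 0₁`. -/
def singleB (n : ℕ) : Matrix (Fin n) (Fin n) ℝ :=
  Matrix.of fun a b => if a = b ∧ a.val < n - 1 then 1 else 0

/-- The objective vector of the single-sequence SDP: `c = e_{n-1} ∈ ℝ^{n-1}`. -/
def singleC (n : ℕ) : Fin (n - 1) → ℝ := fun k => if k.val = n - 2 then 1 else 0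

/-- A positive semidefinite matrix with a zero diagonal entry has zeros in that column. -/
lemma Matrix.PosSemidef.apply_eq_zero_of_diag {ι : Type*} [Fintype ι] {M : Matrix ι ι ℝ}
    (hM : M.PosSemidef) {i : ι} (hi : M i i = 0) (j : ι) : M j i = 0 := by
  classical
  have h := (hM.dotProduct_mulVec_zero_iff (Pi.single i 1)).1 (by simp [hi])
  simpa using congrFun h j

lemma trace_Eij_self_mul {n : ℕ} (i : Fin n) (Y : Matrix (Fin n) (Fin n) ℝ) :
    (Eij n i i * Y).trace = Y i i := by
  have h : Eij n i i = Matrix.single i i 1 := by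
    ext a b
    simp [Eij, Matrix.single_apply, Fin.ext_iff, eq_comm]
  simp [h, Matrix.trace_single_mul]

lemma trace_Eij_mul_of_ne {n : ℕ} {i j : Fin n} (hij : i ≠ j) (Y : Matrix (Fin n) (Fin n) ℝ) :
    (Eij n i j * Y).trace = Y j i + Y i j := by
  have h : Eij n i j = Matrix.single i j 1 + Matrix.single j i 1 := by
    ext a b
    simp only [Eij, Matrix.of_apply, Matrix.add_apply, Matrix.single_apply]
    grind
  simp [h, add_mul, Matrix.trace_single_mul]

lemma singleA'_apply_last_last {n : ℕ} (hn : 3 ≤ n) (k : Fin (n - 1)) :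
    singleA' n k ⟨n - 1, by omega⟩ ⟨n - 1, by omega⟩ = 0 := by
  have hk := k.isLt
  unfold singleA'
  split_ifs <;>
    simp only [Eij, Matrix.of_apply, Matrix.add_apply, Matrix.neg_apply] <;>
    split_ifs <;> first | omega | simp

lemma singleA'_apply_last {n : ℕ} (hn : 3 ≤ n) (k : Fin (n - 1)) :
    singleA' n k ⟨n - 3, by omega⟩ ⟨n - 1, by omega⟩ = singleC n k := by
  have hk := k.isLt
  unfold singleA' singleC
  split_ifs <;>
    simp only [Eij, Matrix.of_apply, Matrix.add_apply, Matrix.neg_apply] <;>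
    split_ifs <;> first | omega | simp_all

lemma singleB_posSemidef (n : ℕ) : (singleB n).PosSemidef := by
  have h : singleB n = Matrix.diagonal fun a : Fin n => if a.val < n - 1 then 1 else 0 := by
    ext a b
    simp only [singleB, Matrix.of_apply, Matrix.diagonal_apply]
    grind
  rw [h]
  exact Matrix.PosSemidef.diagonal fun a => by dsimp only [Pi.zero_apply]; split_ifs <;> simp

/-- Every feasible point of the primal problem has objective value zero. -/
lemma singleC_sum_eq_zero {n : ℕ} (hn : 3 ≤ n) {x : Fin (n - 1) → ℝ}
    (hx : (singleB n - ∑ i, x i • singleA' n i).PosSemidef) : ∑ i, singleC n i * x i = 0 := by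
  have hdiag : (singleB n - ∑ i, x i • singleA' n i)
      ⟨n - 1, by omega⟩ ⟨n - 1, by omega⟩ = 0 := by
    simp [Matrix.sum_apply, singleA'_apply_last_last hn, singleB]
  have h := hx.apply_eq_zero_of_diag hdiag ⟨n - 3, by omega⟩
  have hB : singleB n ⟨n - 3, by omega⟩ ⟨n - 1, by omega⟩ = 0 := by
    simp only [singleB, Matrix.of_apply, Fin.ext_iff]
    exact if_neg (by omega)
  simp only [Matrix.sub_apply, Matrix.sum_apply, Matrix.smul_apply, singleA'_apply_last hn, hB,
    smul_eq_mul, zero_sub, neg_eq_zero] at h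
  simpa only [mul_comm] using h

lemma dual_diag_eq_zero {n : ℕ} {Y : Matrix (Fin n) (Fin n) ℝ} (hY : Y.PosSemidef)
    (h : ∀ k : Fin (n - 1), (singleA' n k * Y).trace = singleC n k) (k : ℕ) (hk : k + 2 < n) :
    Y ⟨k, by omega⟩ ⟨k, by omega⟩ = 0 := by
  induction k with
  | zero =>
    have h0 := h ⟨0, by omega⟩
    have hc : singleC n ⟨0, by omega⟩ = 0 := if_neg (by simp only; omega)
    rw [hc] at h0
    simpa [singleA', trace_Eij_self_mul (⟨0, by omega⟩ : Fin n) Y] using h0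
  | succ k ih =>
    have hcol := hY.apply_eq_zero_of_diag (ih (by omega)) ⟨n - 1, by omega⟩
    have hrow : Y ⟨k, by omega⟩ ⟨n - 1, by omega⟩ = 0 := by
      rw [← hcol]; simpa using (hY.isHermitian.apply ⟨k, by omega⟩ ⟨n - 1, by omega⟩).symm
    have h1 := h ⟨k + 1, by omega⟩
    have hne : k + 1 ≠ n - 2 := by omega
    have hoff := trace_Eij_mul_of_ne (i := (⟨k, by omega⟩ : Fin n)) (j := ⟨n - 1, by omega⟩)
      (by simp only [ne_eq, Fin.mk.injEq]; omega) Y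
    have hself := trace_Eij_self_mul (⟨k + 1, by omega⟩ : Fin n) Y
    simp only [singleA', singleC, hne, if_false, Nat.succ_ne_zero, Nat.add_sub_cancel, add_mul,
      Matrix.trace_add] at h1 hoff hself
    linarith

lemma dual_infeasible {n : ℕ} (hn : 3 ≤ n) :
    ¬ ∃ Y : Matrix (Fin n) (Fin n) ℝ, Y.PosSemidef ∧
      ∀ k : Fin (n - 1), ((singleA' n k) * Y).trace = singleC n k := by
  rintro ⟨Y, hY, h⟩
  have hcol := hY.apply_eq_zero_of_diag (dual_diag_eq_zero hY h (n - 3) (by omega))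
    ⟨n - 1, by omega⟩
  have hrow : Y ⟨n - 3, by omega⟩ ⟨n - 1, by omega⟩ = 0 := by
    rw [← hcol]; simpa using (hY.isHermitian.apply ⟨n - 3, by omega⟩ ⟨n - 1, by omega⟩).symm
  have hlast := h ⟨n - 2, by omega⟩
  have hne : n - 2 ≠ 0 := by omega
  have hoff := trace_Eij_mul_of_ne (i := (⟨n - 3, by omega⟩ : Fin n)) (j := ⟨n - 1, by omega⟩)
    (by simp only [ne_eq, Fin.mk.injEq]; omega) Y
  have hself := trace_Eij_self_mul (⟨n - 2, by omega⟩ : Fin n) Y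
  have hnonneg := hY.diag_nonneg (i := ⟨n - 2, by omega⟩)
  simp only [singleA', singleC, hne, if_false, if_true, add_mul, neg_mul, Matrix.trace_add,
    Matrix.trace_neg] at hlast hoff hself
  linarith

/-- For the modified single-sequence SDP with parameter `n ≥ 3`: `val(P) = 0`,
the dual (D) is infeasible, hence `val(D) = +∞` and the duality gap is infinite. -/
theorem singleSeq_infinite_gap {n : ℕ} (hn : 3 ≤ n) :
    valP (singleA' n) (singleB n) (singleC n) = 0 ∧
    (¬ ∃ Y : Matrix (Fin n) (Fin n) ℝ, Y.PosSemidef ∧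
      ∀ k : Fin (n - 1), ((singleA' n k) * Y).trace = singleC n k) ∧
    valD (singleA' n) (singleB n) (singleC n) = ⊤ := by
  refine ⟨?_, dual_infeasible hn, ?_⟩
  · refine le_antisymm (sSup_le ?_) (le_sSup ⟨0, ?_, by simp⟩)
    · rintro _ ⟨x, hx, rfl⟩
      simp only [singleC_sum_eq_zero hn hx, EReal.coe_zero, le_refl]
    · simpa using singleB_posSemidef n
  · refine sInf_eq_top.2 ?_
    rintro _ ⟨Y, hY, rfl⟩
    exact (dual_infeasible hn ⟨Y, hY⟩).elim
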